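/- For every ε > 0 there exists a constant C = C(ε) > 0 such that for every positive integer m which is a sum of two squares, Σ_{(μ,μ') ∈ E × E, μ ≠ μ'} 1/‖μ − μ'‖ ≤ C · N^ε, where E = {μ ∈ ℤ² : μ₁² + μ₂² = m}, N = #E, and ‖·‖ is the Euclidean norm on ℝ². -/

import Mathlib

open MeasureTheory ProbabilityTheory Real

noncomputable section

/-- The set of lattice points on the circle of radius `√m`:
`E = {μ ∈ ℤ² : μ₁² + μ₂² = m}` (all solutions satisfy `|μᵢ| ≤ m`). -/
def latticeSet (m : ℕ) : Finset (ℤ × ℤ) :=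
  (Finset.Icc (-(m : ℤ)) (m : ℤ) ×ˢ Finset.Icc (-(m : ℤ)) (m : ℤ)).filter
    (fun μ => μ.1 ^ 2 + μ.2 ^ 2 = (m : ℤ))

/-- `N = #E`, the number of lattice points on the circle of radius `√m`. -/
def latN (m : ℕ) : ℕ := (latticeSet m).card

/-- A Gaussian integer lies on the circle of radius `√m` iff its norm is `m`. -/
lemma mem_latticeSet_iff_norm {m : ℕ} (z : GaussianInt) :
    (z.re, z.im) ∈ latticeSet m ↔ z.norm = m := by
  simp only [latticeSet, Finset.mem_filter, Finset.mem_product, Finset.mem_Icc, Zsqrtd.norm_def]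
  constructor
  · rintro ⟨-, h⟩
    linarith
  · intro h
    have h' : z.re ^ 2 + z.im ^ 2 = (m : ℤ) := by linarith
    refine ⟨⟨abs_le.mp ?_, abs_le.mp ?_⟩, h'⟩
    · have : |z.re| ≤ |z.re| ^ 2 := Int.le_self_sq _
      rw [sq_abs] at this
      nlinarith [sq_nonneg z.im]
    · have : |z.im| ≤ |z.im| ^ 2 := Int.le_self_sq _
      rw [sq_abs] at this
      nlinarith [sq_nonneg z.re]

lemma mem_latticeSet {m : ℕ} {μ : ℤ × ℤ} :
    μ ∈ latticeSet m ↔ μ.1 ^ 2 + μ.2 ^ 2 = (m : ℤ) := by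
  have := mem_latticeSet_iff_norm (m := m) ⟨μ.1, μ.2⟩
  simp only [Zsqrtd.norm_def] at this
  rw [show μ = (μ.1, μ.2) from rfl, this]
  constructor <;> intro h <;> linarith

/-- The Gaussian integers of norm `m`. -/
def gaussSet (m : ℕ) : Finset GaussianInt :=
  (latticeSet m).image fun μ => ⟨μ.1, μ.2⟩

lemma mem_gaussSet {m : ℕ} {z : GaussianInt} : z ∈ gaussSet m ↔ z.norm = m := by
  rw [← mem_latticeSet_iff_norm, gaussSet, Finset.mem_image]
  constructor
  · rintro ⟨μ, hμ, rfl⟩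
    exact hμ
  · exact fun h => ⟨_, h, rfl⟩

lemma card_gaussSet (m : ℕ) : (gaussSet m).card = latN m :=
  Finset.card_image_of_injective _ fun μ ν h => by
    simp only [Zsqrtd.mk.injEq] at h
    exact Prod.ext h.1 h.2

lemma exists_prime_dvd_natCast {p : ℕ} (hp : p.Prime) :
    ∃ ϖ : GaussianInt, Prime ϖ ∧ ϖ ∣ (p : GaussianInt) ∧ ∃ j, 0 < j ∧ ϖ.norm = (p : ℤ) ^ j := by
  have hnu : ¬ IsUnit (p : GaussianInt) := by
    rw [← Zsqrtd.norm_eq_one_iff' (by norm_num), Zsqrtd.norm_natCast]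
    have := hp.two_le
    norm_cast
    nlinarith
  have h0 : (p : GaussianInt) ≠ 0 := by exact_mod_cast hp.ne_zero
  obtain ⟨ϖ, hϖ, hdvd⟩ := WfDvdMonoid.exists_irreducible_factor hnu h0
  refine ⟨ϖ, hϖ.prime, hdvd, ?_⟩
  obtain ⟨w, hw⟩ := hdvd
  have hn : ϖ.norm.natAbs ∣ p ^ 2 := by
    refine ⟨w.norm.natAbs, ?_⟩
    rw [← Int.natAbs_mul, ← Zsqrtd.norm_mul, ← hw, Zsqrtd.norm_natCast, Int.natAbs_mul,
      Int.natAbs_natCast, sq]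
  obtain ⟨j, -, hj⟩ := (Nat.dvd_prime_pow hp).mp hn
  refine ⟨j, Nat.pos_of_ne_zero ?_, ?_⟩
  · rintro rfl
    exact hϖ.not_isUnit (Zsqrtd.norm_eq_one_iff.mp (by simpa using hj))
  · rw [← GaussianInt.abs_natCast_norm, hj]
    push_cast
    rfl

/-- Every Gaussian integer of norm `p ^ k * n` with `p ∤ n` is `ϖ ^ a * (star ϖ) ^ b` times one of
norm `n`, where `ϖ` is any Gaussian prime above `p`. -/
lemma exists_eq_pow_mul_star_pow_mul {p n : ℕ} (hp : p.Prime) (hn : ¬ p ∣ n)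
    {ϖ : GaussianInt} (hϖ : Prime ϖ) (hdvd : ϖ ∣ (p : GaussianInt)) {j : ℕ} (hj : 0 < j)
    (hnorm : ϖ.norm = (p : ℤ) ^ j) (k : ℕ) :
    ∀ z : GaussianInt, z.norm = (p ^ k * n : ℕ) →
      ∃ a b : ℕ, a + b ≤ k ∧ ∃ w : GaussianInt, w.norm = n ∧ z = ϖ ^ a * star ϖ ^ b * w := by
  have hp0 : (p : ℤ) ≠ 0 := by exact_mod_cast hp.ne_zero
  induction k using Nat.strong_induction_on with
  | _ k ih =>
  intro z hz
  rcases Nat.eq_zero_or_pos k with rfl | hk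
  · exact ⟨0, 0, le_rfl, z, by simpa using hz, by simp⟩
  have reduce : ∀ ρ z' : GaussianInt, ρ.norm = (p : ℤ) ^ j → z = ρ * z' →
      j ≤ k ∧ z'.norm = (p ^ (k - j) * n : ℕ) := by
    intro ρ z' hρ h
    have h1 : (p : ℤ) ^ j * z'.norm = p ^ k * n := by
      rw [← hρ, ← Zsqrtd.norm_mul, ← h, hz]
      push_cast
      rfl
    have hjk : j ≤ k := by
      by_contra! hlt
      apply hn
      obtain ⟨i, rfl⟩ := Nat.exists_eq_add_of_lt hlt
      have h2 : (p : ℤ) * (p ^ i * z'.norm) = n := by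
        apply mul_left_cancel₀ (pow_ne_zero k hp0)
        rw [← h1]
        ring
      exact Int.natCast_dvd_natCast.mp ⟨_, h2.symm⟩
    refine ⟨hjk, ?_⟩
    apply mul_left_cancel₀ (pow_ne_zero j hp0)
    rw [h1]
    push_cast
    rw [← mul_assoc, ← pow_add, Nat.add_sub_cancel' hjk]
  have hz' : ϖ ∣ z * star z := by
    rw [← Zsqrtd.norm_eq_mul_conj, hz]
    refine hdvd.trans ?_
    obtain ⟨i, rfl⟩ := Nat.exists_eq_add_of_lt hk
    exact ⟨((p ^ i * n : ℕ) : GaussianInt), by push_cast; ring⟩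
  rcases hϖ.dvd_or_dvd hz' with ⟨z', h⟩ | ⟨z', h⟩
  · obtain ⟨hjk, h1⟩ := reduce ϖ z' hnorm h
    obtain ⟨a, b, hab, w, hw, rfl⟩ := ih (k - j) (by omega) z' h1
    exact ⟨a + 1, b, by omega, w, hw, by rw [h]; ring⟩
  · have h' : z = star ϖ * star z' := by
      rw [← star_star z, h, star_mul, mul_comm]
    obtain ⟨hjk, h1⟩ := reduce (star ϖ) (star z') (by rw [Zsqrtd.norm_conj, hnorm]) h'
    obtain ⟨a, b, hab, w, hw, h2⟩ := ih (k - j) (by omega) _ h1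
    exact ⟨a, b + 1, by omega, w, hw, by rw [h', h2]; ring⟩

lemma latN_prime_pow_mul_le {p n : ℕ} (hp : p.Prime) (hn : ¬ p ∣ n) (k : ℕ) :
    latN (p ^ k * n) ≤ (k + 1) ^ 2 * latN n := by
  classical
  obtain ⟨ϖ, hϖ, hdvd, j, hj, hnorm⟩ := exists_prime_dvd_natCast hp
  have hsub : gaussSet (p ^ k * n) ⊆
      ((Finset.range (k + 1) ×ˢ Finset.range (k + 1)) ×ˢ gaussSet n).image
        fun x => ϖ ^ x.1.1 * star ϖ ^ x.1.2 * x.2 := by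
    intro z hz
    obtain ⟨a, b, hab, w, hw, h⟩ :=
      exists_eq_pow_mul_star_pow_mul hp hn hϖ hdvd hj hnorm k z (mem_gaussSet.mp hz)
    refine Finset.mem_image.mpr ⟨((a, b), w), ?_, h.symm⟩
    simp only [Finset.mem_product, Finset.mem_range, mem_gaussSet]
    exact ⟨⟨by omega, by omega⟩, hw⟩
  have := (Finset.card_le_card hsub).trans Finset.card_image_le
  simpa [Finset.card_product, card_gaussSet, sq] using this

lemma latN_one_le : latN 1 ≤ 4 := by decide

/-- The divisor-type bound for the number of lattice points on a circle. -/
lemma latN_le_prod (n : ℕ) (hn : n ≠ 0) :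
    latN n ≤ 4 * ∏ p ∈ n.primeFactors, (n.factorization p + 1) ^ 2 := by
  induction n using Nat.recOnPrimePow with
  | zero => exact absurd rfl hn
  | one => simpa using latN_one_le
  | prime_pow_mul a p k hp hpa hk ih =>
    have ha : a ≠ 0 := by rintro rfl; simp at hpa
    have hcop : Nat.Coprime (p ^ k) a := Nat.Coprime.pow_left k (hp.coprime_iff_not_dvd.mpr hpa)
    have hpf : (p ^ k * a).primeFactors = insert p a.primeFactors := by
      rw [hcop.primeFactors_mul, Nat.primeFactors_prime_pow hk.ne' hp]
      rfl
    have hpn : p ∉ a.primeFactors := fun h => hpa (Nat.dvd_of_mem_primeFactors h)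
    have hfac : (p ^ k * a).factorization p = k := by
      rw [Nat.factorization_mul (pow_ne_zero _ hp.ne_zero) ha]
      simp [hp.factorization_pow, Nat.factorization_eq_zero_of_not_dvd hpa]
    have hfac' : ∀ q ∈ a.primeFactors, (p ^ k * a).factorization q = a.factorization q := by
      intro q hq
      have : p ≠ q := by rintro rfl; exact hpn hq
      rw [Nat.factorization_mul (pow_ne_zero _ hp.ne_zero) ha]
      simp [hp.factorization_pow, this]
    rw [hpf, Finset.prod_insert hpn, hfac,
      Finset.prod_congr rfl fun q hq => by rw [hfac' q hq]]
    calc latN (p ^ k * a) ≤ (k + 1) ^ 2 * latN a := latN_prime_pow_mul_le hp hpa k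
      _ ≤ (k + 1) ^ 2 * (4 * ∏ q ∈ a.primeFactors, (a.factorization q + 1) ^ 2) := by
        gcongr
        exact ih ha
      _ = _ := by ring

/-- If `p ≡ 1 mod 4` divides `m` exactly `k ≥ 1` times, multiplying by `ϖ ^ k` and `(star ϖ) ^ k`
gives two disjoint copies of the points of `m / p ^ k`. -/
lemma two_mul_latN_le {p n k : ℕ} (hp : p.Prime) (hp4 : p % 4 = 1) (hn : ¬ p ∣ n) (hk : 0 < k) :
    2 * latN n ≤ latN (p ^ k * n) := by
  classical
  have : Fact p.Prime := ⟨hp⟩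
  obtain ⟨a, b, hab⟩ := Nat.Prime.sq_add_sq (p := p) (by omega)
  have hp0 := hp.pos
  let ϖ : GaussianInt := ⟨a, b⟩
  have hnorm : ϖ.norm = p := by
    rw [Zsqrtd.norm_def, ← hab]
    push_cast
    ring
  have hnorm' : (star ϖ).norm = p := by rw [Zsqrtd.norm_conj, hnorm]
  have hϖ0 : ϖ ≠ 0 := by
    rw [← GaussianInt.norm_pos, hnorm]
    exact_mod_cast hp0
  have hϖ0' : star ϖ ≠ 0 := by rwa [star_ne_zero]
  have hirr : Irreducible ϖ := by
    rw [irreducible_iff]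
    constructor
    · rw [← Zsqrtd.norm_eq_one_iff' (by norm_num), hnorm]
      exact_mod_cast hp.one_lt.ne'
    · intro x y hxy
      have h := congrArg (fun z : GaussianInt => z.norm.natAbs) hxy
      simp only [hnorm, Zsqrtd.norm_mul, Int.natAbs_mul, Int.natAbs_natCast] at h
      rw [← Zsqrtd.norm_eq_one_iff, ← Zsqrtd.norm_eq_one_iff]
      rcases Nat.prime_mul_iff.mp (h ▸ hp) with h' | h'
      · exact Or.inr h'.2
      · exact Or.inl h'.2
  have hprime : Prime ϖ := hirr.prime
  have hnd : ¬ ϖ ∣ star ϖ := by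
    rintro ⟨x, hx⟩
    have h2 : ϖ ∣ ((2 * a : ℤ) : GaussianInt) := by
      refine ⟨1 + x, ?_⟩
      rw [mul_add, ← hx]
      ext
      · simp [ϖ, two_mul]
      · simp [ϖ]
    obtain ⟨y, hy⟩ := h2
    have h3 : (p : ℤ) ∣ (2 * a) * (2 * a) := by
      refine ⟨y.norm, ?_⟩
      rw [← hnorm, ← Zsqrtd.norm_mul, ← hy, Zsqrtd.norm_intCast]
    have h4 : p ∣ (2 * a) * (2 * a) := by exact_mod_cast h3
    have h5 : p ∣ 2 * a := by rcases hp.dvd_mul.mp h4 with h | h <;> exact h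
    have h6 : p ∣ a := by
      rcases hp.dvd_mul.mp h5 with h | h
      · have := Nat.le_of_dvd (by norm_num) h
        have := hp.two_le
        interval_cases p
        omega
      · exact h
    have ha : a = 0 := by
      by_contra h0
      have h7 := Nat.le_of_dvd (Nat.pos_of_ne_zero h0) h6
      have := hp.two_le
      nlinarith
    subst ha
    apply hp.prime.irreducible.not_isSquare
    exact ⟨b, by nlinarith⟩
  have hdisj : Disjoint ((gaussSet n).image (ϖ ^ k * ·)) ((gaussSet n).image (star ϖ ^ k * ·)) := by
    rw [Finset.disjoint_left]
    rintro z hz hz'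
    obtain ⟨w, hw, rfl⟩ := Finset.mem_image.mp hz
    obtain ⟨w', hw', h⟩ := Finset.mem_image.mp hz'
    have hd : ϖ ∣ star ϖ ^ k * w' := by
      rw [h]
      exact (dvd_pow_self ϖ hk.ne').mul_right w
    rcases hprime.dvd_or_dvd hd with h1 | ⟨x, rfl⟩
    · exact hnd (hprime.dvd_of_dvd_pow h1)
    · have := mem_gaussSet.mp hw'
      rw [Zsqrtd.norm_mul, hnorm] at this
      exact hn (Int.natCast_dvd_natCast.mp ⟨_, this.symm⟩)
  have hsub : ((gaussSet n).image (ϖ ^ k * ·)) ∪ ((gaussSet n).image (star ϖ ^ k * ·)) ⊆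
      gaussSet (p ^ k * n) := by
    have key : ∀ ρ w : GaussianInt, ρ.norm = p → w.norm = n →
        (ρ ^ k * w).norm = (p ^ k * n : ℕ) := by
      intro ρ w hρ hw
      rw [Zsqrtd.norm_mul, show (ρ ^ k).norm = ρ.norm ^ k from map_pow Zsqrtd.normMonoidHom ρ k,
        hρ, hw]
      push_cast
      rfl
    intro z hz
    rw [mem_gaussSet]
    rcases Finset.mem_union.mp hz with h | h <;> obtain ⟨w, hw, rfl⟩ := Finset.mem_image.mp h
    · exact key _ _ hnorm (mem_gaussSet.mp hw)
    · exact key _ _ hnorm' (mem_gaussSet.mp hw)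
  have hc := Finset.card_le_card hsub
  rw [Finset.card_union_of_disjoint hdisj,
    Finset.card_image_of_injective _ (mul_right_injective₀ (pow_ne_zero k hϖ0)),
    Finset.card_image_of_injective _ (mul_right_injective₀ (pow_ne_zero k hϖ0')),
    card_gaussSet, card_gaussSet] at hc
  omega

/-- The prime factors of `m` that split in the Gaussian integers. -/
def splitPrimes (m : ℕ) : Finset ℕ := m.primeFactors.filter fun p => p % 4 = 1

lemma two_pow_card_splitPrimes_le (m : ℕ) (hm : m ≠ 0) (h : 0 < latN m) :
    2 ^ (splitPrimes m).card ≤ latN m := by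
  induction m using Nat.strong_induction_on with
  | _ m ih =>
  rcases (splitPrimes m).eq_empty_or_nonempty with he | ⟨p, hps⟩
  · simpa [he] using Nat.one_le_iff_ne_zero.mpr h.ne'
  obtain ⟨hpm, hp4⟩ := Finset.mem_filter.mp hps
  have hp := Nat.prime_of_mem_primeFactors hpm
  obtain ⟨k, n, hn, rfl⟩ := Nat.exists_eq_pow_mul_and_not_dvd hm p hp.ne_one
  have hn0 : n ≠ 0 := by rintro rfl; simp at hn
  have hk : 0 < k := by
    rcases Nat.eq_zero_or_pos k with rfl | hk
    · exact absurd (by simpa using Nat.dvd_of_mem_primeFactors hpm) hn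
    · exact hk
  have hlt : n < p ^ k * n :=
    lt_mul_of_one_lt_left (Nat.pos_of_ne_zero hn0) (Nat.one_lt_pow hk.ne' hp.one_lt)
  have hpos : 0 < latN n := by
    have := latN_prime_pow_mul_le hp hn k
    by_contra! h0
    simp_all
  have hsub : splitPrimes (p ^ k * n) ⊆ insert p (splitPrimes n) := by
    intro q hq
    obtain ⟨hq1, hq4⟩ := Finset.mem_filter.mp hq
    have hqp := Nat.prime_of_mem_primeFactors hq1
    rcases hqp.dvd_mul.mp (Nat.dvd_of_mem_primeFactors hq1) with h1 | h1
    · rw [(Nat.prime_dvd_prime_iff_eq hqp hp).mp (hqp.dvd_of_dvd_pow h1)]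
      exact Finset.mem_insert_self _ _
    · exact Finset.mem_insert_of_mem
        (Finset.mem_filter.mpr ⟨Nat.mem_primeFactors.mpr ⟨hqp, h1, hn0⟩, hq4⟩)
  calc 2 ^ (splitPrimes (p ^ k * n)).card
      ≤ 2 ^ ((splitPrimes n).card + 1) :=
        Nat.pow_le_pow_right (by norm_num)
          ((Finset.card_le_card hsub).trans (Finset.card_insert_le _ _))
    _ = 2 * 2 ^ (splitPrimes n).card := by ring
    _ ≤ 2 * latN n := by gcongr; exact ih n hlt hn0 hpos
    _ ≤ _ := two_mul_latN_le hp hp4 hn hk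

lemma prod_le_pow_mul_prod {S : Finset ℕ} {g h : ℕ → ℝ} {A : ℝ} (hA : 1 ≤ A) (P : ℕ)
    (hg : ∀ p ∈ S, 0 ≤ g p) (hh : ∀ p ∈ S, 0 ≤ h p) (hle : ∀ p ∈ S, g p ≤ A * h p)
    (hlarge : ∀ p ∈ S, P ≤ p → g p ≤ h p) :
    ∏ p ∈ S, g p ≤ A ^ P * ∏ p ∈ S, h p := by
  calc ∏ p ∈ S, g p ≤ ∏ p ∈ S, (if p < P then A else 1) * h p := by
        refine Finset.prod_le_prod hg fun p hp => ?_
        split_ifs with hlt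
        · exact hle p hp
        · simpa using hlarge p hp (not_lt.mp hlt)
    _ = A ^ (S.filter (· < P)).card * ∏ p ∈ S, h p := by
        rw [Finset.prod_mul_distrib, Finset.prod_ite, Finset.prod_const, Finset.prod_const_one,
          mul_one]
    _ ≤ A ^ P * ∏ p ∈ S, h p := by
        refine mul_le_mul_of_nonneg_right (pow_le_pow_right₀ hA ?_) (Finset.prod_nonneg hh)
        calc (S.filter (· < P)).card ≤ (Finset.range P).card :=
              Finset.card_le_card fun p hp => Finset.mem_range.mpr (Finset.mem_filter.mp hp).2
          _ = P := Finset.card_range P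

lemma exists_succ_sq_le_rpow {δ : ℝ} (hδ : 0 < δ) :
    ∃ A : ℝ, 1 ≤ A ∧ ∃ P : ℕ, ∀ p k : ℕ, 2 ≤ p →
      ((k : ℝ) + 1) ^ 2 ≤ A * ((p : ℝ) ^ k) ^ δ ∧
        (P ≤ p → ((k : ℝ) + 1) ^ 2 ≤ ((p : ℝ) ^ k) ^ δ) := by
  have hlog : 0 < Real.log 2 := Real.log_pos one_lt_two
  set c : ℝ := δ / 2 * Real.log 2 with hc
  have hc0 : 0 < c := by positivity
  have hsplit : ∀ p k : ℕ, ((p : ℝ) ^ k) ^ δ = (((p : ℝ) ^ (δ / 2)) ^ k) ^ 2 := by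
    intro p k
    rw [Real.rpow_pow_comm p.cast_nonneg, ← Real.rpow_mul_natCast (by positivity)]
    congr 1
    push_cast
    ring
  refine ⟨(1 + c⁻¹) ^ 2, one_le_pow₀ (by have := inv_pos.mpr hc0; linarith),
    ⌈(2 : ℝ) ^ (2 / δ)⌉₊, fun p k hp => ⟨?_, fun hP => ?_⟩⟩
  · have hp' : (2 : ℝ) ≤ p := by exact_mod_cast hp
    have h1 : 1 + c * k ≤ ((p : ℝ) ^ (δ / 2)) ^ k := by
      calc 1 + c * k ≤ Real.exp (c * k) := by linarith [Real.add_one_le_exp (c * k)]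
        _ = ((2 : ℝ) ^ (δ / 2)) ^ k := by
          rw [Real.rpow_def_of_pos two_pos, ← Real.exp_nat_mul, hc]
          congr 1
          ring
        _ ≤ ((p : ℝ) ^ (δ / 2)) ^ k := by gcongr
    rw [hsplit, ← mul_pow]
    gcongr
    calc (k : ℝ) + 1 ≤ k + 1 + (c * k + c⁻¹) := by
          have : 0 ≤ c * k + c⁻¹ := by positivity
          linarith
      _ = (1 + c⁻¹) * (1 + c * k) := by field_simp; ring
      _ ≤ _ := by gcongr
  · have h2 : (2 : ℝ) ≤ (p : ℝ) ^ (δ / 2) := by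
      have hP' : (2 : ℝ) ^ (2 / δ) ≤ p := (Nat.le_ceil _).trans (by exact_mod_cast hP)
      calc (2 : ℝ) = ((2 : ℝ) ^ (2 / δ)) ^ (δ / 2) := by
            rw [← Real.rpow_mul two_pos.le, div_mul_div_cancel₀ hδ.ne', div_self two_ne_zero,
              Real.rpow_one]
        _ ≤ _ := by gcongr
    rw [hsplit]
    gcongr
    calc (k : ℝ) + 1 ≤ 2 ^ k := by exact_mod_cast Nat.lt_two_pow_self
      _ ≤ _ := by gcongr

lemma exists_latN_le_rpow {δ : ℝ} (hδ : 0 < δ) :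
    ∃ C : ℝ, 0 < C ∧ ∀ n : ℕ, n ≠ 0 → (latN n : ℝ) ≤ C * (n : ℝ) ^ δ := by
  obtain ⟨A, hA, P, h⟩ := exists_succ_sq_le_rpow hδ
  refine ⟨4 * A ^ P, by positivity, fun n hn => ?_⟩
  have hprod : ∏ p ∈ n.primeFactors, ((p : ℝ) ^ n.factorization p) ^ δ = (n : ℝ) ^ δ := by
    rw [Real.finsetProd_rpow _ _ fun p _ => by positivity]
    congr 1
    conv_rhs =>
      rw [← Nat.prod_factorization_pow_eq_self hn, Nat.prod_factorization_eq_prod_primeFactors]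
    push_cast
    rfl
  calc (latN n : ℝ)
      ≤ 4 * ∏ p ∈ n.primeFactors, ((n.factorization p : ℝ) + 1) ^ 2 := by
        exact_mod_cast latN_le_prod n hn
    _ ≤ 4 * (A ^ P * ∏ p ∈ n.primeFactors, ((p : ℝ) ^ n.factorization p) ^ δ) := by
        gcongr
        have h2 : ∀ p ∈ n.primeFactors, 2 ≤ p := fun p hp =>
          (Nat.prime_of_mem_primeFactors hp).two_le
        exact prod_le_pow_mul_prod hA P (fun p _ => by positivity) (fun p _ => by positivity)
          (fun p hp => (h p _ (h2 p hp)).1) (fun p hp => (h p _ (h2 p hp)).2)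
    _ = 4 * A ^ P * (n : ℝ) ^ δ := by rw [hprod]; ring

lemma exists_sum_factoredNumbers_rpow_le {s ε : ℝ} (hs : s < 0) (hε : 0 < ε) :
    ∃ K : ℝ, 0 < K ∧ ∀ S T : Finset ℕ, (∀ n ∈ T, n ∈ Nat.factoredNumbers S) →
      ∑ n ∈ T, (n : ℝ) ^ s ≤ K * ((2 : ℝ) ^ ε) ^ S.card := by
  let f : ℕ →* ℝ :=
    { toFun := fun n => (n : ℝ) ^ s
      map_one' := by simp
      map_mul' := fun m n => by
        push_cast
        exact Real.mul_rpow (by positivity) (by positivity) }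
  have hf0 : ∀ n, 0 ≤ f n := fun n => Real.rpow_nonneg (Nat.cast_nonneg n) s
  have h2s : (2 : ℝ) ^ s < 1 := Real.rpow_lt_one_of_one_lt_of_neg one_lt_two hs
  have hf2 : ∀ {p : ℕ}, 2 ≤ p → f p ≤ (2 : ℝ) ^ s := fun {p} hp =>
    Real.rpow_le_rpow_of_nonpos two_pos (by exact_mod_cast hp) hs.le
  have hf1 : ∀ {p : ℕ}, p.Prime → ‖f p‖ < 1 := fun {p} hp => by
    rw [Real.norm_of_nonneg (hf0 p)]
    exact (hf2 hp.two_le).trans_lt h2s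
  have hone : (1 : ℝ) ≤ 2 ^ ε := Real.one_le_rpow one_le_two hε.le
  set A : ℝ := (1 - (2 : ℝ) ^ s)⁻¹ with hAdef
  have hA : 1 ≤ A := by
    rw [hAdef, one_le_inv₀ (by linarith)]
    have := Real.rpow_pos_of_pos two_pos s
    linarith
  have htend : Filter.Tendsto (fun n : ℕ => (1 - f n)⁻¹) Filter.atTop (nhds 1) := by
    have h0 : Filter.Tendsto (fun n : ℕ => f n) Filter.atTop (nhds 0) := by
      have := (tendsto_rpow_neg_atTop (neg_pos.mpr hs)).comp
        (tendsto_natCast_atTop_atTop (R := ℝ))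
      simpa [f, Function.comp_def] using this
    simpa using (h0.const_sub 1).inv₀ (by norm_num)
  obtain ⟨P, hP⟩ := Filter.eventually_atTop.mp
    (htend.eventually_le_const (Real.one_lt_rpow one_lt_two hε))
  refine ⟨A ^ P, by positivity, fun S T hT => ?_⟩
  obtain ⟨hsum, hhas⟩ :=
    EulerProduct.summable_and_hasSum_factoredNumbers_prod_filter_prime_geometric hf1 S
  have hmem : ∀ p ∈ S.filter Nat.Prime, p.Prime := fun p hp => (Finset.mem_filter.mp hp).2
  have hfle : ∀ p ∈ S.filter Nat.Prime, 0 < 1 - f p := fun p hp => by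
    have := hf2 (hmem p hp).two_le
    linarith
  calc ∑ n ∈ T, (n : ℝ) ^ s
      = ∑ n ∈ T.subtype (· ∈ Nat.factoredNumbers S), f n :=
        (Finset.sum_subtype_of_mem (fun n : ℕ => f n) hT).symm
    _ ≤ ∏ p ∈ S with p.Prime, (1 - f p)⁻¹ := sum_le_hasSum _ (fun n _ => hf0 n) hhas
    _ ≤ A ^ P * ∏ p ∈ S with p.Prime, (2 : ℝ) ^ ε := by
        refine prod_le_pow_mul_prod hA P (fun p hp => (inv_pos.mpr (hfle p hp)).le)
          (fun p _ => by positivity) (fun p hp => ?_) (fun p _ hp => hP p hp)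
        calc (1 - f p)⁻¹ ≤ A :=
              inv_anti₀ (by linarith) (by linarith [hf2 (hmem p hp).two_le])
          _ ≤ A * 2 ^ ε := le_mul_of_one_le_right (by positivity) hone
    _ ≤ A ^ P * ((2 : ℝ) ^ ε) ^ S.card := by
        rw [Finset.prod_const]
        gcongr
        exact Finset.filter_subset _ _

lemma natAbs_sq_add_sq_mem_factoredNumbers {m : ℕ} (hm : m ≠ 0) {a b : ℤ} (hab : IsCoprime a b)
    (hdvd : a ^ 2 + b ^ 2 ∣ 4 * m) :
    (a ^ 2 + b ^ 2).natAbs ∈ Nat.factoredNumbers (insert 2 (splitPrimes m)) := by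
  have hdvd' : (a ^ 2 + b ^ 2).natAbs ∣ 4 * m := by
    have := Int.natAbs_dvd_natAbs.mpr hdvd
    rwa [Int.natAbs_mul, Int.natAbs_natCast] at this
  rw [Nat.mem_factoredNumbers_iff_forall_le]
  have hn0 : (a ^ 2 + b ^ 2).natAbs ≠ 0 := ne_zero_of_dvd_ne_zero (by positivity) hdvd'
  refine ⟨hn0, fun p _ hp hpn => ?_⟩
  have hmod : p % 4 ≠ 3 :=
    Nat.mod_four_ne_three_of_mem_primeFactors_of_isSquare_neg_one
      (Nat.mem_primeFactors.mpr ⟨hp, hpn, hn0⟩)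
      (ZMod.isSquare_neg_one_of_eq_sq_add_sq_of_isCoprime rfl hab)
  rcases hp.eq_two_or_odd with rfl | hodd
  · exact Finset.mem_insert_self _ _
  refine Finset.mem_insert_of_mem (Finset.mem_filter.mpr ⟨?_, by omega⟩)
  refine Nat.mem_primeFactors.mpr ⟨hp, ?_, hm⟩
  rcases hp.dvd_mul.mp (hpn.trans hdvd') with h | h
  · have h2 : p ∣ 2 := hp.dvd_of_dvd_pow (show p ∣ 2 ^ 2 from h)
    have := (Nat.prime_dvd_prime_iff_eq hp Nat.prime_two).mp h2
    omega
  · exact h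

lemma exists_sum_primitive_le {ε : ℝ} (hε : 0 < ε) :
    ∃ K : ℝ, 0 < K ∧ ∀ m : ℕ, m ≠ 0 → ∀ V : Finset (ℤ × ℤ),
      (∀ v ∈ V, IsCoprime v.1 v.2 ∧ v.1 ^ 2 + v.2 ^ 2 ∣ 4 * (m : ℤ)) →
      ∑ v ∈ V, (√((v.1 : ℝ) ^ 2 + (v.2 : ℝ) ^ 2))⁻¹ ≤ K * ((2 : ℝ) ^ ε) ^ (splitPrimes m).card := by
  obtain ⟨C, hC, hCle⟩ := exists_latN_le_rpow (δ := 1 / 4) (by norm_num)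
  obtain ⟨K, hK, hKle⟩ := exists_sum_factoredNumbers_rpow_le (s := -1 / 4) (by norm_num) hε
  refine ⟨C * K * 2 ^ ε, by positivity, fun m hm V hV => ?_⟩
  let nrm : ℤ × ℤ → ℕ := fun v => (v.1 ^ 2 + v.2 ^ 2).natAbs
  have hnrm : ∀ v, ((nrm v : ℕ) : ℤ) = v.1 ^ 2 + v.2 ^ 2 := fun v =>
    Int.natAbs_of_nonneg (by positivity)
  have hfact : ∀ n ∈ V.image nrm, n ∈ Nat.factoredNumbers (insert 2 (splitPrimes m)) := by
    intro n hn
    obtain ⟨v, hv, rfl⟩ := Finset.mem_image.mp hn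
    exact natAbs_sq_add_sq_mem_factoredNumbers hm (hV v hv).1 (hV v hv).2
  have hfib : ∀ n ∈ V.image nrm,
      ∑ v ∈ V with nrm v = n, (√((v.1 : ℝ) ^ 2 + (v.2 : ℝ) ^ 2))⁻¹ ≤ C * (n : ℝ) ^ (-1 / 4 : ℝ) := by
    intro n hn
    have hn0 : n ≠ 0 := Nat.ne_zero_of_mem_factoredNumbers (hfact n hn)
    have hnpos : (0 : ℝ) < n := by exact_mod_cast Nat.pos_of_ne_zero hn0
    have hterm : ∀ v ∈ V.filter (nrm · = n),
        (√((v.1 : ℝ) ^ 2 + (v.2 : ℝ) ^ 2))⁻¹ = (n : ℝ) ^ (-1 / 2 : ℝ) := by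
      intro v hv
      have h1 : (n : ℝ) = (v.1 : ℝ) ^ 2 + (v.2 : ℝ) ^ 2 := by
        rw [← (Finset.mem_filter.mp hv).2]
        exact_mod_cast hnrm v
      rw [← h1, Real.sqrt_eq_rpow, ← Real.rpow_neg hnpos.le]
      norm_num
    have hcard : (V.filter (nrm · = n)).card ≤ latN n := by
      refine Finset.card_le_card fun v hv => mem_latticeSet.mpr ?_
      rw [← hnrm, (Finset.mem_filter.mp hv).2]
    calc ∑ v ∈ V with nrm v = n, (√((v.1 : ℝ) ^ 2 + (v.2 : ℝ) ^ 2))⁻¹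
        = (V.filter (nrm · = n)).card * (n : ℝ) ^ (-1 / 2 : ℝ) := by
          rw [Finset.sum_congr rfl hterm, Finset.sum_const, nsmul_eq_mul]
      _ ≤ (C * (n : ℝ) ^ (1 / 4 : ℝ)) * (n : ℝ) ^ (-1 / 2 : ℝ) := by
          gcongr
          exact (Nat.cast_le.mpr hcard).trans (hCle n hn0)
      _ = C * (n : ℝ) ^ (-1 / 4 : ℝ) := by
          rw [mul_assoc, ← Real.rpow_add hnpos]
          norm_num
  calc ∑ v ∈ V, (√((v.1 : ℝ) ^ 2 + (v.2 : ℝ) ^ 2))⁻¹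
      = ∑ n ∈ V.image nrm, ∑ v ∈ V with nrm v = n, (√((v.1 : ℝ) ^ 2 + (v.2 : ℝ) ^ 2))⁻¹ :=
        (Finset.sum_fiberwise_of_maps_to (fun v hv => Finset.mem_image_of_mem nrm hv) _).symm
    _ ≤ ∑ n ∈ V.image nrm, C * (n : ℝ) ^ (-1 / 4 : ℝ) := Finset.sum_le_sum hfib
    _ ≤ C * (K * ((2 : ℝ) ^ ε) ^ (insert 2 (splitPrimes m)).card) := by
        rw [← Finset.mul_sum]
        gcongr
        exact hKle _ _ hfact
    _ ≤ C * (K * ((2 : ℝ) ^ ε) ^ ((splitPrimes m).card + 1)) := by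
        gcongr
        · exact Real.one_le_rpow one_le_two hε.le
        · exact Finset.card_insert_le _ _
    _ = _ := by ring

/-- The difference of two distinct points of a circle is `g` times a primitive vector `(a, b)`,
and their sum is an integer multiple of the orthogonal vector `(-b, a)`. -/
lemma exists_primitive_direction {μ ν : ℤ × ℤ} (hne : μ ≠ ν)
    (h : μ.1 ^ 2 + μ.2 ^ 2 = ν.1 ^ 2 + ν.2 ^ 2) :
    ∃ a b g s : ℤ, 0 < g ∧ IsCoprime a b ∧ μ.1 - ν.1 = g * a ∧ μ.2 - ν.2 = g * b ∧
      μ.1 + ν.1 = -(s * b) ∧ μ.2 + ν.2 = s * a := by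
  have hg : 0 < Int.gcd (μ.1 - ν.1) (μ.2 - ν.2) := by
    rw [Int.gcd_pos_iff]
    by_contra! h0
    exact hne (Prod.ext (by linarith [h0.1]) (by linarith [h0.2]))
  obtain ⟨a, b, hab, ha, hb⟩ := Int.exists_gcd_one hg
  set g : ℤ := (Int.gcd (μ.1 - ν.1) (μ.2 - ν.2) : ℤ) with hgdef
  have hg' : 0 < g := Int.natCast_pos.mpr hg
  have hcop : IsCoprime a b := Int.isCoprime_iff_gcd_eq_one.mpr hab
  have horth : a * (μ.1 + ν.1) + b * (μ.2 + ν.2) = 0 := by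
    apply mul_left_cancel₀ hg'.ne'
    linear_combination h - (μ.1 + ν.1) * ha - (μ.2 + ν.2) * hb
  obtain ⟨u, v, huv⟩ := hcop
  refine ⟨a, b, g, u * (μ.2 + ν.2) - v * (μ.1 + ν.1), hg', ⟨u, v, huv⟩, by linarith, by linarith,
    ?_, ?_⟩
  · linear_combination (-(μ.1 + ν.1)) * huv + u * horth
  · linear_combination (-(μ.2 + ν.2)) * huv + v * horth

/-- On a large circle, two lattice points whose first coordinates are small and nonnegative have
the same first coordinate. -/
lemma not_lt_of_sq_add_sq_eq {g₁ g₂ s₁ s₂ X : ℤ} (hX : g₂ ^ 2 < X)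
    (h : g₁ ^ 2 + s₁ ^ 2 = g₂ ^ 2 + s₂ ^ 2) (hlarge : X + X ^ 2 ≤ g₂ ^ 2 + s₂ ^ 2) (hg₁ : 0 ≤ g₁) :
    ¬ g₁ < g₂ := by
  intro hlt
  have h1 : |s₂| < |s₁| := sq_lt_sq.mp (by nlinarith)
  have h2 := sq_abs s₁
  have h3 := sq_abs s₂
  have h4 := abs_nonneg s₂
  have h5 : |s₁| < X := by nlinarith [sq_nonneg g₁]
  nlinarith [sq_nonneg g₁]

/-- The inverse distances of close pairs on a circle with few lattice points, relative to its
radius, are controlled by the primitive Gaussian divisors of `4 * m`: each primitive direction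
occurs at most twice. -/
lemma exists_primitive_sum_bound {m : ℕ} (hm : m ≠ 0) {X : ℤ} (hX : X ^ 3 ≤ 2 * m)
    {Q : Finset ((ℤ × ℤ) × (ℤ × ℤ))}
    (hQ : ∀ q ∈ Q, q.1 ∈ latticeSet m ∧ q.2 ∈ latticeSet m ∧ q.1 ≠ q.2 ∧
      (q.1.1 - q.2.1) ^ 2 + (q.1.2 - q.2.2) ^ 2 < X) :
    ∃ V : Finset (ℤ × ℤ), (∀ v ∈ V, IsCoprime v.1 v.2 ∧ v.1 ^ 2 + v.2 ^ 2 ∣ 4 * (m : ℤ)) ∧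
      ∑ q ∈ Q, (√(((q.1.1 : ℝ) - q.2.1) ^ 2 + ((q.1.2 : ℝ) - q.2.2) ^ 2))⁻¹ ≤
        2 * ∑ v ∈ V, (√((v.1 : ℝ) ^ 2 + (v.2 : ℝ) ^ 2))⁻¹ := by
  classical
  have hex : ∀ q : (ℤ × ℤ) × (ℤ × ℤ), ∃ a b g s : ℤ, q ∈ Q →
      0 < g ∧ IsCoprime a b ∧ q.1.1 - q.2.1 = g * a ∧ q.1.2 - q.2.2 = g * b ∧
        q.1.1 + q.2.1 = -(s * b) ∧ q.1.2 + q.2.2 = s * a := by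
    intro q
    by_cases hq : q ∈ Q
    · obtain ⟨h1, h2, hne, -⟩ := hQ q hq
      rw [mem_latticeSet] at h1 h2
      obtain ⟨a, b, g, s, h⟩ := exists_primitive_direction hne (h1.trans h2.symm)
      exact ⟨a, b, g, s, fun _ => h⟩
    · exact ⟨0, 0, 0, 0, fun h => absurd h hq⟩
  choose a b g s hex using hex
  have hmul : ∀ q ∈ Q, (a q ^ 2 + b q ^ 2) * (g q ^ 2 + s q ^ 2) = 4 * m := by
    intro q hq
    obtain ⟨-, -, e1, e2, e3, e4⟩ := hex q hq
    obtain ⟨h1, h2, -, -⟩ := hQ q hq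
    rw [mem_latticeSet] at h1 h2
    calc (a q ^ 2 + b q ^ 2) * (g q ^ 2 + s q ^ 2)
        = (g q * a q) ^ 2 + (g q * b q) ^ 2 + (-(s q * b q)) ^ 2 + (s q * a q) ^ 2 := by ring
      _ = 4 * (m : ℤ) := by
        rw [← e1, ← e2, ← e3, ← e4]
        linear_combination 2 * h1 + 2 * h2
  have hm0 : (0 : ℤ) < m := by exact_mod_cast Nat.pos_of_ne_zero hm
  have hpos : ∀ q ∈ Q, 0 < a q ^ 2 + b q ^ 2 := by
    intro q hq
    refine lt_of_le_of_ne (by positivity) fun h0 => ?_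
    have := hmul q hq
    rw [← h0] at this
    linarith
  have hle : ∀ q ∈ Q, a q ^ 2 + b q ^ 2 ≤ g q ^ 2 * (a q ^ 2 + b q ^ 2) := fun q hq =>
    le_mul_of_one_le_left (hpos q hq).le (one_le_pow₀ (hex q hq).1)
  have hlt : ∀ q ∈ Q, g q ^ 2 * (a q ^ 2 + b q ^ 2) < X := by
    intro q hq
    obtain ⟨-, -, e1, e2, -, -⟩ := hex q hq
    have := (hQ q hq).2.2.2
    rw [e1, e2] at this
    linarith
  have hg2 : ∀ q ∈ Q, g q ^ 2 < X := fun q hq => by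
    nlinarith [hlt q hq, hpos q hq, sq_nonneg (g q)]
  have hlarge : ∀ q ∈ Q, X + X ^ 2 ≤ g q ^ 2 + s q ^ 2 := by
    intro q hq
    have h1 := hpos q hq
    have h2 : a q ^ 2 + b q ^ 2 < X := (hle q hq).trans_lt (hlt q hq)
    have h3 := hmul q hq
    by_contra! hcon
    have hX1 : 1 ≤ X := by linarith
    have h4 : g q ^ 2 + s q ^ 2 < 2 * X ^ 2 := by nlinarith
    have h5 : (a q ^ 2 + b q ^ 2) * (g q ^ 2 + s q ^ 2) < X * (2 * X ^ 2) :=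
      mul_lt_mul'' h2 h4 (by positivity) (by positivity)
    nlinarith
  let Φ : (ℤ × ℤ) × (ℤ × ℤ) → (ℤ × ℤ) × Bool := fun q => ((a q, b q), decide (0 ≤ s q))
  have hinj : Set.InjOn Φ Q := by
    intro q hq r hr hqr
    simp only [Φ, Prod.mk.injEq, decide_eq_decide] at hqr
    obtain ⟨⟨ha, hb⟩, hs⟩ := hqr
    have hM : g q ^ 2 + s q ^ 2 = g r ^ 2 + s r ^ 2 := by
      apply mul_left_cancel₀ (hpos q hq).ne'
      rw [hmul q hq, ha, hb, hmul r hr]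
    obtain ⟨hgq, -, e1, e2, e3, e4⟩ := hex q hq
    obtain ⟨hgr, -, f1, f2, f3, f4⟩ := hex r hr
    have hg : g q = g r := le_antisymm
      (not_lt.mp (not_lt_of_sq_add_sq_eq (hg2 q hq) hM.symm (hlarge q hq) hgr.le))
      (not_lt.mp (not_lt_of_sq_add_sq_eq (hg2 r hr) hM (hlarge r hr) hgq.le))
    have hs' : s q = s r := by
      rw [hg] at hM
      rcases sq_eq_sq_iff_eq_or_eq_neg.mp (add_left_cancel hM) with h | h
      · exact h
      · omega
    rw [ha, hg] at e1
    rw [hb, hg] at e2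
    rw [hb, hs'] at e3
    rw [ha, hs'] at e4
    ext <;> linarith
  refine ⟨Q.image fun q => (a q, b q), fun v hv => ?_, ?_⟩
  · obtain ⟨q, hq, rfl⟩ := Finset.mem_image.mp hv
    exact ⟨(hex q hq).2.1, ⟨_, (hmul q hq).symm⟩⟩
  let F : (ℤ × ℤ) × Bool → ℝ := fun x => (√((x.1.1 : ℝ) ^ 2 + (x.1.2 : ℝ) ^ 2))⁻¹
  calc ∑ q ∈ Q, (√(((q.1.1 : ℝ) - q.2.1) ^ 2 + ((q.1.2 : ℝ) - q.2.2) ^ 2))⁻¹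
      ≤ ∑ q ∈ Q, F (Φ q) := by
        refine Finset.sum_le_sum fun q hq => ?_
        obtain ⟨-, -, e1, e2, -, -⟩ := hex q hq
        have h1 : (0 : ℝ) < (a q : ℝ) ^ 2 + (b q : ℝ) ^ 2 := by exact_mod_cast hpos q hq
        refine inv_anti₀ (Real.sqrt_pos.mpr h1) (Real.sqrt_le_sqrt ?_)
        have h2 : a q ^ 2 + b q ^ 2 ≤ (q.1.1 - q.2.1) ^ 2 + (q.1.2 - q.2.2) ^ 2 := by
          rw [e1, e2]
          linarith [hle q hq]
        exact_mod_cast h2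
    _ = ∑ x ∈ Q.image Φ, F x := (Finset.sum_image hinj).symm
    _ ≤ ∑ x ∈ (Q.image fun q => (a q, b q)) ×ˢ Finset.univ, F x := by
        refine Finset.sum_le_sum_of_subset_of_nonneg ?_ fun x _ _ => by positivity
        intro x hx
        obtain ⟨q, hq, rfl⟩ := Finset.mem_image.mp hx
        simp only [Finset.mem_product, Finset.mem_univ, and_true]
        exact Finset.mem_image_of_mem (fun q => (a q, b q)) hq
    _ = _ := by
        rw [Finset.sum_product, Finset.mul_sum]
        refine Finset.sum_congr rfl fun v _ => ?_
        simp [F, two_mul]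

lemma inv_dist_le_one {μ ν : ℤ × ℤ} (h : μ ≠ ν) :
    (√(((μ.1 : ℝ) - ν.1) ^ 2 + ((μ.2 : ℝ) - ν.2) ^ 2))⁻¹ ≤ 1 := by
  have h1 : 0 < (μ.1 - ν.1) ^ 2 + (μ.2 - ν.2) ^ 2 := by
    by_contra! h0
    have h2 : μ.1 - ν.1 = 0 := by nlinarith [sq_nonneg (μ.1 - ν.1), sq_nonneg (μ.2 - ν.2)]
    have h3 : μ.2 - ν.2 = 0 := by nlinarith [sq_nonneg (μ.1 - ν.1), sq_nonneg (μ.2 - ν.2)]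
    exact h (Prod.ext (by linarith) (by linarith))
  apply inv_le_one_of_one_le₀
  rw [Real.one_le_sqrt]
  exact_mod_cast h1

/-- The Riesz-type energy sum over distinct pairs of lattice points is `O(N^ε)`. -/
theorem riesz_energy_bound :
    ∀ ε > (0:ℝ), ∃ C > 0, ∀ m : ℕ, 0 < m →
      (∃ a b : ℤ, a ^ 2 + b ^ 2 = (m : ℤ)) →
      (∑ μ ∈ latticeSet m, ∑ μ' ∈ latticeSet m,
          if μ ≠ μ' then
            (Real.sqrt (((μ.1 : ℝ) - (μ'.1 : ℝ)) ^ 2 + ((μ.2 : ℝ) - (μ'.2 : ℝ)) ^ 2))⁻¹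
          else 0)
        ≤ C * (latN m : ℝ) ^ ε := by
  intro ε hε
  obtain ⟨C, hC, hCle⟩ := exists_latN_le_rpow (δ := 1 / 24) (by norm_num)
  obtain ⟨K, hK, hKle⟩ := exists_sum_primitive_le hε
  refine ⟨1 + 2 * K + C ^ 4, by positivity, fun m hm0 hm2 => ?_⟩
  have hm : m ≠ 0 := hm0.ne'
  set N := latN m with hN
  have hNpos : 0 < N := by
    obtain ⟨a, b, hab⟩ := hm2
    exact Finset.card_pos.mpr ⟨(a, b), mem_latticeSet.mpr hab⟩
  have hN1 : (1 : ℝ) ≤ N := by exact_mod_cast hNpos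
  have hNε : (1 : ℝ) ≤ (N : ℝ) ^ ε := Real.one_le_rpow hN1 hε.le
  let D : (ℤ × ℤ) × (ℤ × ℤ) → ℝ := fun q =>
    (√(((q.1.1 : ℝ) - q.2.1) ^ 2 + ((q.1.2 : ℝ) - q.2.2) ^ 2))⁻¹
  let P := (latticeSet m ×ˢ latticeSet m).filter fun q => q.1 ≠ q.2
  have hPcard : (P.card : ℝ) ≤ (N : ℝ) ^ 2 := by
    have := Finset.card_filter_le (latticeSet m ×ˢ latticeSet m) fun q => q.1 ≠ q.2
    rw [Finset.card_product, ← sq] at this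
    exact_mod_cast this
  have hsum : (∑ μ ∈ latticeSet m, ∑ μ' ∈ latticeSet m,
      if μ ≠ μ' then
        (Real.sqrt (((μ.1 : ℝ) - (μ'.1 : ℝ)) ^ 2 + ((μ.2 : ℝ) - (μ'.2 : ℝ)) ^ 2))⁻¹
      else 0) = ∑ q ∈ P, D q := by
    rw [Finset.sum_filter, Finset.sum_product]
  rw [hsum]
  by_cases hlarge : N ^ 12 ≤ 2 * m
  · have hfar : ∑ q ∈ P with ¬ (q.1.1 - q.2.1) ^ 2 + (q.1.2 - q.2.2) ^ 2 < (N : ℤ) ^ 4, D q ≤ 1 := by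
      have hterm : ∀ q ∈ P.filter
          fun q => ¬ (q.1.1 - q.2.1) ^ 2 + (q.1.2 - q.2.2) ^ 2 < (N : ℤ) ^ 4,
          D q ≤ ((N : ℝ) ^ 2)⁻¹ := by
        intro q hq
        have h1 := not_lt.mp (Finset.mem_filter.mp hq).2
        refine inv_anti₀ (by positivity) (Real.le_sqrt_of_sq_le ?_)
        rw [← pow_mul]
        exact_mod_cast h1
      calc _ ≤ _ := Finset.sum_le_card_nsmul _ _ _ hterm
        _ ≤ (N : ℝ) ^ 2 * ((N : ℝ) ^ 2)⁻¹ := by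
          rw [nsmul_eq_mul]
          gcongr
          exact (Nat.cast_le.mpr (Finset.card_filter_le _ _)).trans hPcard
        _ = 1 := mul_inv_cancel₀ (by positivity)
    obtain ⟨V, hV, hVle⟩ := exists_primitive_sum_bound hm (X := (N : ℤ) ^ 4)
      (Q := P.filter fun q => (q.1.1 - q.2.1) ^ 2 + (q.1.2 - q.2.2) ^ 2 < (N : ℤ) ^ 4)
      (by rw [← pow_mul]; exact_mod_cast hlarge)
      (fun q hq => by
        obtain ⟨h1, h2⟩ := Finset.mem_filter.mp hq
        obtain ⟨h3, h4⟩ := Finset.mem_filter.mp h1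
        exact ⟨(Finset.mem_product.mp h3).1, (Finset.mem_product.mp h3).2, h4, h2⟩)
    have hsplit : ((2 : ℝ) ^ ε) ^ (splitPrimes m).card ≤ (N : ℝ) ^ ε := by
      rw [Real.rpow_pow_comm two_pos.le]
      gcongr
      exact_mod_cast two_pow_card_splitPrimes_le m hm hNpos
    calc ∑ q ∈ P, D q
        = _ + _ := (Finset.sum_filter_add_sum_filter_not P
          (fun q => (q.1.1 - q.2.1) ^ 2 + (q.1.2 - q.2.2) ^ 2 < (N : ℤ) ^ 4) D).symm
      _ ≤ 2 * (K * ((2 : ℝ) ^ ε) ^ (splitPrimes m).card) + 1 :=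
        add_le_add (hVle.trans (by gcongr; exact hKle m hm V hV)) hfar
      _ ≤ 2 * (K * (N : ℝ) ^ ε) + (N : ℝ) ^ ε := by gcongr
      _ ≤ 2 * (K * (N : ℝ) ^ ε) + (N : ℝ) ^ ε + C ^ 4 * (N : ℝ) ^ ε := by
        have : 0 ≤ C ^ 4 * (N : ℝ) ^ ε := by positivity
        linarith
      _ = _ := by ring
  · have hm_le : (m : ℝ) ≤ (N : ℝ) ^ 12 := by
      exact_mod_cast (show m ≤ N ^ 12 by omega)
    have hN24 : (N : ℝ) ^ 24 ≤ C ^ 24 * m := by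
      calc (N : ℝ) ^ 24 ≤ (C * (m : ℝ) ^ (1 / 24 : ℝ)) ^ 24 := by gcongr; exact hCle m hm
        _ = C ^ 24 * m := by
          rw [mul_pow, ← Real.rpow_mul_natCast (by positivity)]
          norm_num
    have hN2 : (N : ℝ) ≤ C ^ 2 := by
      refine le_of_pow_le_pow_left₀ (n := 12) (by norm_num) (by positivity) ?_
      refine le_of_mul_le_mul_right ?_ (show (0 : ℝ) < (N : ℝ) ^ 12 by positivity)
      calc (N : ℝ) ^ 12 * (N : ℝ) ^ 12 = (N : ℝ) ^ 24 := by ring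
        _ ≤ C ^ 24 * m := hN24
        _ ≤ C ^ 24 * (N : ℝ) ^ 12 := by gcongr
        _ = (C ^ 2) ^ 12 * (N : ℝ) ^ 12 := by ring
    calc ∑ q ∈ P, D q ≤ P.card • (1 : ℝ) :=
          Finset.sum_le_card_nsmul _ _ _ fun q hq => inv_dist_le_one (Finset.mem_filter.mp hq).2
      _ ≤ (N : ℝ) ^ 2 := by simpa using hPcard
      _ ≤ (C ^ 2) ^ 2 := by gcongr
      _ = C ^ 4 * 1 := by ring
      _ ≤ (1 + 2 * K + C ^ 4) * (N : ℝ) ^ ε := by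
        gcongr
        linarith

end
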